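/- Let R be a ring. A right R-module T is a partial silting module (i.e. there exists a projective presentation σ of T, a 2-term complex of projectives with H^0(σ) = T, such that T ∈ D_σ and D_σ is closed under coproducts) if and only if there exists a 2-term partial silting complex σ in K^b(Proj R) with H^0(σ) = T. -/

import Mathlib

open CategoryTheory Limits Pretriangulated

universe u

namespace Glue

noncomputable section

variable (R : Type u) [Ring R]

instance hasDerivedCategoryModule : HasDerivedCategory (ModuleCat.{u} R) :=
  HasDerivedCategory.standard _

variable {R}

/-- A class of objects is closed under (set-indexed) coproducts. -/
def ClosedUnderCoproducts {C : Type*} [Category C] (S : Set C) : Prop :=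
  ∀ (J : Type*) (f : J → C) (c : Cofan f), IsColimit c → (∀ j, f j ∈ S) → c.pt ∈ S

/-- A 2-term complex of projectives: a cochain complex of projective modules
concentrated in degrees `-1` and `0`. -/
def TwoTermProj (σ : CochainComplex (ModuleCat.{u} R) ℤ) : Prop :=
  (∀ n : ℤ, Projective (σ.X n)) ∧ (∀ n : ℤ, n ≠ -1 → n ≠ 0 → IsZero (σ.X n))

/-- The class `D_σ` of modules `M` such that `Hom_R(σ, M)` is surjective. -/
def Dclass (σ : CochainComplex (ModuleCat.{u} R) ℤ) : Set (ModuleCat.{u} R) :=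
  {M | Function.Surjective (fun φ : σ.X 0 ⟶ M => σ.d (-1) 0 ≫ φ)}

/-- A 2-term complex of projectives `σ` is a partial silting object of `D(R)`:
`σ ∈ σ^{⊥>0}` and `σ^{⊥>0}` is closed under coproducts. -/
def IsPartialSiltingComplex (σ : CochainComplex (ModuleCat.{u} R) ℤ) : Prop :=
  (∀ i : ℤ, 0 < i →
    ∀ f : DerivedCategory.Q.obj σ ⟶ (DerivedCategory.Q.obj σ)⟦i⟧, f = 0) ∧
  ClosedUnderCoproducts
    {Z : DerivedCategory (ModuleCat.{u} R) |
      ∀ i : ℤ, 0 < i → ∀ f : DerivedCategory.Q.obj σ ⟶ Z⟦i⟧, f = 0}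

/-- A family of morphisms with the same target is jointly epimorphic. -/
def JointlyEpi {C : Type*} [Category* C] {J : Type*} {f : J → C} {X : C}
    (ι : ∀ j, f j ⟶ X) : Prop :=
  ∀ ⦃Y : C⦄ (g g' : X ⟶ Y), (∀ j, ι j ≫ g = ι j ≫ g') → g = g'

/-- `p` is a family of retractions of `ι`, orthogonal to each other. -/
structure OrthogonalRetractions {C : Type*} [Category* C] [HasZeroMorphisms C] {J : Type*}
    {f : J → C} {X : C} (ι : ∀ j, f j ⟶ X) (p : ∀ j, X ⟶ f j) : Prop where
  comp_self : ∀ j, ι j ≫ p j = 𝟙 (f j)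
  comp_of_ne : ∀ i j, i ≠ j → ι i ≫ p j = 0

section

variable {C D : Type*} [Category* C] [Category* D] {J : Type*} {f : J → C} {X : C}

lemma JointlyEpi.of_isColimit {c : Cofan f} (hc : IsColimit c) : JointlyEpi c.inj :=
  fun _ _ _ h => Cofan.IsColimit.hom_ext hc _ _ h

lemma JointlyEpi.of_iso {ι : ∀ j, f j ⟶ X} (hι : JointlyEpi ι) {f' : J → C} {X' : C}
    {ι' : ∀ j, f' j ⟶ X'} (e : ∀ j, f j ⟶ f' j) (φ : X ≅ X')
    (comm : ∀ j, ι j ≫ φ.hom = e j ≫ ι' j) : JointlyEpi ι' := fun Y g g' h => by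
  rw [← cancel_epi φ.hom]
  refine hι _ _ (fun j => ?_)
  rw [reassoc_of% (comm j), reassoc_of% (comm j), h]

variable [HasZeroMorphisms C] [HasZeroMorphisms D]

lemma exists_orthogonalRetractions {c : Cofan f} (hc : IsColimit c) :
    ∃ p : ∀ j, c.pt ⟶ f j, OrthogonalRetractions c.inj p := by
  classical
  refine ⟨fun j => Cofan.IsColimit.desc hc
    (fun i => if h : i = j then eqToHom (by rw [h]) else 0), ⟨fun j => ?_, fun i j h => ?_⟩⟩
  · simp
  · simp [h]

lemma OrthogonalRetractions.map {ι : ∀ j, f j ⟶ X} {p : ∀ j, X ⟶ f j}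
    (h : OrthogonalRetractions ι p) (F : C ⥤ D) [F.PreservesZeroMorphisms] :
    OrthogonalRetractions (f := fun j => F.obj (f j))
      (fun j => F.map (ι j)) (fun j => F.map (p j)) where
  comp_self j := by rw [← F.map_comp, h.comp_self, F.map_id]
  comp_of_ne i j hij := by rw [← F.map_comp, h.comp_of_ne i j hij, F.map_zero]

end

section

variable {J : Type*} {f : J → ModuleCat.{u} R} {X : ModuleCat.{u} R}
  {ι : ∀ j, f j ⟶ X} {p : ∀ j, X ⟶ f j}

lemma JointlyEpi.iSup_range_eq_top (hι : JointlyEpi ι) :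
    ⨆ j, LinearMap.range (ι j).hom = ⊤ := by
  set N := ⨆ j, LinearMap.range (ι j).hom with hN
  have := hι (ModuleCat.ofHom N.mkQ) 0 (fun j => by
    ext x
    simp only [ModuleCat.hom_comp, ModuleCat.hom_ofHom, LinearMap.comp_apply, comp_zero,
      ModuleCat.hom_zero, LinearMap.zero_apply, Submodule.mkQ_apply,
      Submodule.Quotient.mk_eq_zero]
    exact (le_iSup (fun j => LinearMap.range (ι j).hom) j) ⟨x, rfl⟩)
  rw [← N.ker_mkQ, LinearMap.ker_eq_top]
  exact congrArg ModuleCat.Hom.hom this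

lemma OrthogonalRetractions.exists_sum (h : OrthogonalRetractions ι p) (hι : JointlyEpi ι)
    (x : X) : ∃ s : Finset J, ∑ j ∈ s, (ι j).hom ((p j).hom x) = x := by
  classical
  suffices ∃ s : Finset J, ∀ t, s ⊆ t → ∑ j ∈ t, (ι j).hom ((p j).hom x) = x by
    obtain ⟨s, hs⟩ := this
    exact ⟨s, hs s subset_rfl⟩
  have hx : x ∈ ⨆ j, LinearMap.range (ι j).hom := by
    rw [hι.iSup_range_eq_top]; trivial
  induction hx using Submodule.iSup_induction' with
  | mem i x hx =>
    obtain ⟨y, rfl⟩ := hx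
    refine ⟨{i}, fun t ht => ?_⟩
    have h1 : (p i).hom ((ι i).hom y) = y := by
      simpa using congrArg (fun k => k.hom y) (h.comp_self i)
    rw [Finset.sum_eq_single i, h1]
    · intro j _ hj
      have h2 : (p j).hom ((ι i).hom y) = 0 := by
        simpa using congrArg (fun k => k.hom y) (h.comp_of_ne i j hj.symm)
      rw [h2, map_zero]
    · intro hi
      exact (hi (ht (by simp))).elim
  | zero => exact ⟨∅, fun t _ => by simp⟩
  | add x y _ _ hx hy =>
    obtain ⟨s, hs⟩ := hx
    obtain ⟨s', hs'⟩ := hy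
    refine ⟨s ∪ s', fun t ht => ?_⟩
    simp only [map_add, Finset.sum_add_distrib]
    rw [hs t (Finset.union_subset_left ht), hs' t (Finset.union_subset_right ht)]

lemma OrthogonalRetractions.eq_zero (h : OrthogonalRetractions ι p) (hι : JointlyEpi ι)
    {Y : ModuleCat.{u} R} (g : Y ⟶ X) (hg : ∀ j, g ≫ p j = 0) : g = 0 := by
  ext y
  obtain ⟨s, hs⟩ := h.exists_sum hι (g.hom y)
  rw [← hs]
  refine Finset.sum_eq_zero (fun j _ => ?_)
  have : (p j).hom (g.hom y) = 0 := by simpa using congrArg (fun k => k.hom y) (hg j)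
  rw [this, map_zero]

/-- A jointly epimorphic family of modules with orthogonal retractions is a coproduct. -/
lemma OrthogonalRetractions.nonempty_isColimit {J : Type u} {f : J → ModuleCat.{u} R}
    {X : ModuleCat.{u} R} {ι : ∀ j, f j ⟶ X} {p : ∀ j, X ⟶ f j}
    (h : OrthogonalRetractions ι p) (hι : JointlyEpi ι) :
    Nonempty (IsColimit (Cofan.mk X ι)) := by
  obtain ⟨q, hq⟩ := exists_orthogonalRetractions (coproductIsCoproduct f)
  have hf := JointlyEpi.of_isColimit (coproductIsCoproduct f)
  let θ : ∐ f ⟶ X := Sigma.desc ι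
  have hθ (j) : Sigma.ι f j ≫ θ = ι j := by simp [θ]
  have : Epi θ := ⟨fun g g' hg => hι _ _ (fun j => by
    rw [← hθ, Category.assoc, Category.assoc, hg])⟩
  have hp (j) : θ ≫ p j = q j := hf _ _ (fun i => by
    by_cases hij : i = j
    · subst hij
      exact (by simp [θ, h.comp_self] : Sigma.ι f i ≫ θ ≫ p i = _).trans (hq.comp_self i).symm
    · exact (by simp [θ, h.comp_of_ne i j hij] : Sigma.ι f i ≫ θ ≫ p j = _).trans
        (hq.comp_of_ne i j hij).symm)
  have : Mono θ := Preadditive.mono_of_cancel_zero _ (fun g hg => hq.eq_zero hf g (fun j => by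
    rw [← hp, reassoc_of% hg, zero_comp]))
  have : IsIso θ := isIso_of_mono_of_epi θ
  exact ⟨(coproductIsCoproduct f).ofIsoColimit (Cofan.ext (asIso θ) (fun j => hθ j))⟩

end

section

open HomologicalComplex

/-- Cohomology of complexes of modules sends coproduct inclusions to a jointly epimorphic
family. -/
lemma jointlyEpi_homologyMap {J : Type*} {K : J → CochainComplex (ModuleCat.{u} R) ℤ}
    {X : CochainComplex (ModuleCat.{u} R) ℤ} {ι : ∀ j, K j ⟶ X} {p : ∀ j, X ⟶ K j}
    (h : OrthogonalRetractions ι p) (n : ℤ)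
    (hι : JointlyEpi (fun j => (ι j).f n)) :
    JointlyEpi (fun j => homologyMap (ι j) n) := by
  intro Y g g' hg
  ext x
  obtain ⟨z, rfl⟩ := (ModuleCat.epi_iff_surjective (X.homologyπ n)).1 inferInstance x
  obtain ⟨s, hs⟩ := (h.map (HomologicalComplex.eval _ _ n)).exists_sum hι ((X.iCycles n).hom z)
  have hz : ∑ j ∈ s, (cyclesMap (ι j) n).hom ((cyclesMap (p j) n).hom z) = z := by
    apply (ModuleCat.mono_iff_injective (X.iCycles n)).1 inferInstance
    refine Eq.trans ?_ hs
    erw [map_sum]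
    refine Finset.sum_congr rfl (fun j _ => ?_)
    have := cyclesMap_i (p j ≫ ι j) n
    rw [cyclesMap_comp] at this
    exact congrArg (fun k => k.hom z) this
  rw [← hz]
  simp only [map_sum]
  refine Finset.sum_congr rfl (fun j _ => ?_)
  have e : cyclesMap (ι j) n ≫ X.homologyπ n ≫ g = cyclesMap (ι j) n ≫ X.homologyπ n ≫ g' := by
    rw [← homologyπ_naturality_assoc, ← homologyπ_naturality_assoc, hg j]
  exact congrArg (fun k => k.hom ((cyclesMap (p j) n).hom z)) e

end

section

lemma jointlyEpi_homologyMap_of_isColimit {J : Type u}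
    {K : J → CochainComplex (ModuleCat.{u} R) ℤ} {c : Cofan K} (hc : IsColimit c) (n : ℤ) :
    JointlyEpi (fun j => HomologicalComplex.homologyMap (c.inj j) n) := by
  obtain ⟨p, hp⟩ := exists_orthogonalRetractions hc
  refine jointlyEpi_homologyMap hp n ?_
  exact JointlyEpi.of_isColimit
    (isColimitCofanMkObjOfIsColimit (HomologicalComplex.eval _ _ n) _ _
      (hc.ofIsoColimit (Cofan.ext (Iso.refl _))))

open DerivedCategory

lemma jointlyEpi_homologyFunctor_map_Q {J : Type u}
    {K : J → CochainComplex (ModuleCat.{u} R) ℤ} {c : Cofan K} (hc : IsColimit c) (n : ℤ) :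
    JointlyEpi (fun j => (homologyFunctor _ n).map (Q.map (c.inj j))) :=
  (jointlyEpi_homologyMap_of_isColimit hc n).of_iso
    (fun j => (homologyFunctorFactors _ n).inv.app (K j))
    ((homologyFunctorFactors _ n).symm.app c.pt)
    (fun j => (homologyFunctorFactors (ModuleCat.{u} R) n).inv.naturality (c.inj j))

/-- A morphism in the derived category between coproducts of complexes is an isomorphism if it
is induced by isomorphisms between the summands. -/
lemma isIso_of_isIso_summands {J : Type u} {K L : J → CochainComplex (ModuleCat.{u} R) ℤ}
    {c : Cofan K} (hc : IsColimit c) {d : Cofan L} (hd : IsColimit d)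
    (φ : Q.obj c.pt ⟶ Q.obj d.pt) (e : ∀ j, Q.obj (K j) ⟶ Q.obj (L j)) [∀ j, IsIso (e j)]
    (comm : ∀ j, Q.map (c.inj j) ≫ φ = e j ≫ Q.map (d.inj j)) : IsIso φ := by
  rw [isIso_iff]
  intro n
  obtain ⟨p, hp⟩ := exists_orthogonalRetractions hc
  obtain ⟨q, hq⟩ := exists_orthogonalRetractions hd
  obtain ⟨hc'⟩ := ((hp.map Q).map (homologyFunctor _ n)).nonempty_isColimit
    (jointlyEpi_homologyFunctor_map_Q hc n)
  obtain ⟨hd'⟩ := ((hq.map Q).map (homologyFunctor _ n)).nonempty_isColimit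
    (jointlyEpi_homologyFunctor_map_Q hd n)
  refine ⟨Cofan.IsColimit.desc hd' (fun j =>
    (homologyFunctor _ n).map (inv (e j) ≫ Q.map (c.inj j))), ?_, ?_⟩
  · refine Cofan.IsColimit.hom_ext hc' _ _ (fun j => ?_)
    have h := Cofan.IsColimit.fac hd' (fun j =>
      (homologyFunctor _ n).map (inv (e j) ≫ Q.map (c.inj j))) j
    dsimp at h ⊢
    rw [← Functor.map_comp_assoc, comm, Functor.map_comp_assoc]
    erw [h]
    rw [← Functor.map_comp]
    simp
  · refine Cofan.IsColimit.hom_ext hd' _ _ (fun j => ?_)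
    have h := Cofan.IsColimit.fac hd' (fun j =>
      (homologyFunctor _ n).map (inv (e j) ≫ Q.map (c.inj j))) j
    dsimp at h ⊢
    erw [reassoc_of% h]
    rw [← Functor.map_comp, Category.assoc, comm]
    simp

lemma exists_desc_Q {J : Type u} {K : J → CochainComplex (ModuleCat.{u} R) ℤ} {c : Cofan K}
    (hc : IsColimit c) {Y : DerivedCategory (ModuleCat.{u} R)} (f : ∀ j, Q.obj (K j) ⟶ Y) :
    ∃ φ : Q.obj c.pt ⟶ Y, ∀ j, Q.map (c.inj j) ≫ φ = f j := by
  wlog hY : ∃ L, Y = Q.obj L generalizing Y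
  · obtain ⟨φ, hφ⟩ := this (fun j => f j ≫ (Q.objObjPreimageIso Y).inv) ⟨_, rfl⟩
    exact ⟨φ ≫ (Q.objObjPreimageIso Y).hom, fun j => by rw [reassoc_of% (hφ j)]; simp⟩
  obtain ⟨L, rfl⟩ := hY
  choose K' s hs g hg using fun j => right_fac (f j)
  let S : ∐ K' ⟶ c.pt := Sigma.desc (fun j => s j ≫ c.inj j)
  have hS (j) : Sigma.ι K' j ≫ S = s j ≫ c.inj j := by simp [S]
  have : IsIso (Q.map S) := isIso_of_isIso_summands (coproductIsCoproduct K') hc (Q.map S)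
    (fun j => Q.map (s j)) (fun j => by
      rw [← Functor.map_comp, ← Functor.map_comp, ← hS]; rfl)
  refine ⟨inv (Q.map S) ≫ Q.map (Sigma.desc g), fun j => ?_⟩
  have h1 : Q.map (c.inj j) ≫ inv (Q.map S) = inv (Q.map (s j)) ≫ Q.map (Sigma.ι K' j) := by
    rw [IsIso.comp_inv_eq, Category.assoc, IsIso.eq_inv_comp, ← Functor.map_comp,
      ← Functor.map_comp, hS]
  rw [reassoc_of% h1, ← Functor.map_comp, Sigma.ι_desc, hg]

lemma jointlyEpi_Q_map {J : Type u} {K : J → CochainComplex (ModuleCat.{u} R) ℤ} {c : Cofan K}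
    (hc : IsColimit c) : JointlyEpi (fun j => Q.map (c.inj j)) := by
  suffices ∀ ⦃Y : DerivedCategory (ModuleCat.{u} R)⦄ (g : Q.obj c.pt ⟶ Y),
      (∀ j, Q.map (c.inj j) ≫ g = 0) → g = 0 by
    intro Y g g' h
    rw [← sub_eq_zero]
    exact this _ (fun j => by rw [Preadditive.comp_sub, h, sub_self])
  intro Y g hg
  obtain ⟨W, i, m, hT⟩ := distinguished_cocone_triangle₁ g
  have ht (j) : ∃ t : Q.obj (K j) ⟶ W, Q.map (c.inj j) = t ≫ i :=
    Triangle.coyoneda_exact₂ _ hT (Q.map (c.inj j)) (hg j)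
  choose t ht using ht
  obtain ⟨φ, hφ⟩ : ∃ φ : Q.obj c.pt ⟶ W, ∀ j, Q.map (c.inj j) ≫ φ = t j := exists_desc_Q hc t
  have : IsIso (φ ≫ i) := isIso_of_isIso_summands hc hc _ (fun j => 𝟙 _) (fun j => by
    rw [reassoc_of% (hφ j), Category.id_comp]
    exact (ht j).symm)
  have hi : i ≫ g = 0 := comp_distTriang_mor_zero₁₂ _ hT
  rw [← cancel_epi (φ ≫ i), Category.assoc, hi, comp_zero, comp_zero]

/-- The localization functor to the derived category preserves coproducts. -/
lemma nonempty_isColimit_Q {J : Type u} {K : J → CochainComplex (ModuleCat.{u} R) ℤ}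
    {c : Cofan K} (hc : IsColimit c) :
    Nonempty (IsColimit (Cofan.mk (Q.obj c.pt) (fun j => Q.map (c.inj j)))) := by
  choose φ hφ using fun (s : Cofan fun j => Q.obj (K j)) => exists_desc_Q hc s.inj
  exact ⟨Cofan.IsColimit.mk _ φ hφ (fun s m hm => jointlyEpi_Q_map hc _ _
    (fun j => (hm j).trans (hφ s j).symm))⟩

/-- Cohomology on the derived category of modules preserves coproducts. -/
lemma nonempty_isColimit_homologyFunctor {J : Type u}
    {Z : J → DerivedCategory (ModuleCat.{u} R)} {c : Cofan Z} (hc : IsColimit c) (n : ℤ) :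
    Nonempty (IsColimit (Cofan.mk ((homologyFunctor _ n).obj c.pt)
      (fun j => (homologyFunctor _ n).map (c.inj j)))) := by
  obtain ⟨p, hp⟩ := exists_orthogonalRetractions hc
  refine (hp.map (homologyFunctor _ n)).nonempty_isColimit ?_
  let K (j) := Q.objPreimage (Z j)
  let e (j) : Q.obj (K j) ≅ Z j := Q.objObjPreimageIso (Z j)
  obtain ⟨hQ⟩ := nonempty_isColimit_Q (coproductIsCoproduct K)
  let φ : Q.obj (∐ K) ⟶ c.pt := Cofan.IsColimit.desc hQ (fun j => (e j).hom ≫ c.inj j)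
  have hφ (j) : Q.map (Sigma.ι K j) ≫ φ = (e j).hom ≫ c.inj j :=
    Cofan.IsColimit.fac hQ (fun j => (e j).hom ≫ c.inj j) j
  let ψ : c.pt ⟶ Q.obj (∐ K) :=
    Cofan.IsColimit.desc hc (fun j => (e j).inv ≫ Q.map (Sigma.ι K j))
  have hψ (j) : c.inj j ≫ ψ = (e j).inv ≫ Q.map (Sigma.ι K j) :=
    Cofan.IsColimit.fac hc (fun j => (e j).inv ≫ Q.map (Sigma.ι K j)) j
  have : IsIso φ := by
    refine ⟨ψ, jointlyEpi_Q_map (coproductIsCoproduct K) _ _ (fun j => ?_),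
      Cofan.IsColimit.hom_ext hc _ _ (fun j => ?_)⟩
    · change Q.map (Sigma.ι K j) ≫ φ ≫ ψ = Q.map (Sigma.ι K j) ≫ 𝟙 _
      rw [reassoc_of% (hφ j), hψ]
      simp
    · rw [reassoc_of% (hψ j), hφ]
      simp
  refine (jointlyEpi_homologyFunctor_map_Q (coproductIsCoproduct K) n).of_iso
    (fun j => (homologyFunctor _ n).map (e j).hom) ((homologyFunctor _ n).mapIso (asIso φ))
    (fun j => ?_)
  dsimp
  rw [← Functor.map_comp, ← Functor.map_comp, ← hφ]

end

/-- The class of modules `M` such that `Hom_R(σ, M)` is injective. -/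
def InjClass (σ : CochainComplex (ModuleCat.{u} R) ℤ) : Set (ModuleCat.{u} R) :=
  {M | ∀ φ : σ.X 0 ⟶ M, σ.d (-1) 0 ≫ φ = 0 → φ = 0}

section

variable {σ M : CochainComplex (ModuleCat.{u} R) ℤ}

lemma TwoTermProj.exists_hom (hσ : TwoTermProj σ) (a : σ.X (-1) ⟶ M.X (-1)) (b : σ.X 0 ⟶ M.X 0)
    (hab : a ≫ M.d (-1) 0 = σ.d (-1) 0 ≫ b) (hb : b ≫ M.d 0 1 = 0) :
    ∃ f : σ ⟶ M, f.f (-1) = a ∧ f.f 0 = b := by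
  let F : ∀ n, σ.X n ⟶ M.X n := Function.update (Function.update (fun _ => 0) 0 b) (-1) a
  have h₁ : F (-1) = a := Function.update_self ..
  have h₀ : F 0 = b := by simp [F]
  refine ⟨{ f := F, comm' := ?_ }, h₁, h₀⟩
  rintro i _ rfl
  by_cases h : i = -1
  · subst h
    change F (-1) ≫ M.d (-1) 0 = σ.d (-1) 0 ≫ F 0
    rw [h₁, h₀, hab]
  by_cases h' : i = 0
  · subst h'
    change F 0 ≫ M.d 0 1 = σ.d 0 1 ≫ F 1
    rw [h₀, hb, (hσ.2 1 (by decide) (by decide)).eq_of_tgt (σ.d 0 1) 0, zero_comp]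
  exact (hσ.2 i h h').eq_of_src _ _

lemma TwoTermProj.nonempty_homotopy_zero (hσ : TwoTermProj σ) (f : σ ⟶ M)
    (s : σ.X (-1) ⟶ M.X (-2)) (t : σ.X 0 ⟶ M.X (-1))
    (h₁ : f.f (-1) = σ.d (-1) 0 ≫ t + s ≫ M.d (-2) (-1)) (h₀ : f.f 0 = t ≫ M.d (-1) 0) :
    Nonempty (Homotopy f 0) := by
  let h : ∀ i j, σ.X i ⟶ M.X j :=
    Function.update (Function.update (fun _ _ => 0) 0 (Function.update (fun _ => 0) (-1) t)) (-1)
      (Function.update (fun _ => 0) (-2) s)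
  have hs : h (-1) (-2) = s := by simp [h]
  have ht : h 0 (-1) = t := by simp [h]
  have hz : h 1 0 = 0 := by simp [h]
  refine ⟨{ hom := h, zero := ?_, comm := ?_ }⟩
  · intro i j hij
    by_cases hi : i = -1
    · subst hi
      have : j ≠ -2 := by rintro rfl; exact hij rfl
      simp [h, this]
    by_cases hi' : i = 0
    · subst hi'
      have : j ≠ -1 := by rintro rfl; exact hij rfl
      simp [h, this]
    exact (hσ.2 i hi hi').eq_of_src _ _
  · intro i
    by_cases hi : i = -1
    · subst hi
      rw [dNext_eq h (show (ComplexShape.up ℤ).Rel (-1) 0 by simp),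
        prevD_eq h (show (ComplexShape.up ℤ).Rel (-2) (-1) by simp), hs, ht, h₁]
      simp
    by_cases hi' : i = 0
    · subst hi'
      rw [dNext_eq h (show (ComplexShape.up ℤ).Rel 0 1 by simp),
        prevD_eq h (show (ComplexShape.up ℤ).Rel (-1) 0 by simp), hz, ht, h₀]
      simp
    exact (hσ.2 i hi hi').eq_of_src _ _

lemma homotopy_zero_f_neg_one {f : σ ⟶ M} (h : Homotopy f 0) :
    f.f (-1) = σ.d (-1) 0 ≫ h.hom 0 (-1) + h.hom (-1) (-2) ≫ M.d (-2) (-1) := by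
  have := h.comm (-1)
  rwa [dNext_eq h.hom (show (ComplexShape.up ℤ).Rel (-1) 0 by simp),
    prevD_eq h.hom (show (ComplexShape.up ℤ).Rel (-2) (-1) by simp), HomologicalComplex.zero_f,
    add_zero] at this

lemma TwoTermProj.homotopy_zero_f_zero (hσ : TwoTermProj σ) {f : σ ⟶ M} (h : Homotopy f 0) :
    f.f 0 = h.hom 0 (-1) ≫ M.d (-1) 0 := by
  have := h.comm 0
  rwa [dNext_eq h.hom (show (ComplexShape.up ℤ).Rel 0 1 by simp),
    prevD_eq h.hom (show (ComplexShape.up ℤ).Rel (-1) 0 by simp), HomologicalComplex.zero_f,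
    add_zero, (hσ.2 1 (by decide) (by decide)).eq_of_tgt (σ.d 0 1) 0, zero_comp, zero_add] at this

/-- A morphism from a projective object to cycles with vanishing cohomology class is a boundary. -/
lemma exists_toCycles_of_comp_homologyπ_eq_zero {P : ModuleCat.{u} R} [Projective P] {i j : ℤ}
    (hij : i + 1 = j) (z : P ⟶ M.cycles j) (hz : z ≫ M.homologyπ j = 0) :
    ∃ s : P ⟶ M.X i, s ≫ M.toCycles i j = z := by
  have hS : (ShortComplex.mk (M.toCycles i j) (M.homologyπ j) (by simp)).Exact :=
    ShortComplex.exact_of_g_is_cokernel _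
      (M.homologyIsCokernel i j ((ComplexShape.up ℤ).prev_eq' hij))
  exact ⟨hS.liftFromProjective z hz, hS.liftFromProjective_comp z hz⟩

theorem TwoTermProj.forall_nonempty_homotopy_zero_iff (hσ : TwoTermProj σ) :
    (∀ f : σ ⟶ M, Nonempty (Homotopy f 0)) ↔
      M.homology (-1) ∈ Dclass σ ∧ M.homology 0 ∈ InjClass σ := by
  have := hσ.1
  refine ⟨fun H => ⟨fun a => ?_, fun b hb => ?_⟩, fun ⟨hD, hI⟩ f => ?_⟩
  · let a' := Projective.factorThru a (M.homologyπ (-1))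
    have ha' : a' ≫ M.homologyπ (-1) = a := Projective.factorThru_comp _ _
    obtain ⟨f, h₁, h₀⟩ := hσ.exists_hom (M := M) (a' ≫ M.iCycles (-1)) 0 (by simp) (by simp)
    obtain ⟨h⟩ := H f
    have e₁ := homotopy_zero_f_neg_one h
    have e₀ := hσ.homotopy_zero_f_zero h
    rw [h₁] at e₁
    rw [h₀] at e₀
    let t := M.liftCycles (h.hom 0 (-1)) 0 (by simp) e₀.symm
    refine ⟨t ≫ M.homologyπ (-1), ?_⟩
    have : a' = σ.d (-1) 0 ≫ t + h.hom (-1) (-2) ≫ M.toCycles (-2) (-1) := by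
      rw [← cancel_mono (M.iCycles (-1)), e₁]
      simp [t]
    simp [← ha', this]
  · let b' := Projective.factorThru b (M.homologyπ 0)
    have hb' : b' ≫ M.homologyπ 0 = b := Projective.factorThru_comp _ _
    obtain ⟨s, hs⟩ := exists_toCycles_of_comp_homologyπ_eq_zero (i := -1) (by simp)
      (σ.d (-1) 0 ≫ b') (by rw [Category.assoc, hb', hb])
    obtain ⟨f, h₁, h₀⟩ := hσ.exists_hom (M := M) s (b' ≫ M.iCycles 0)
      (by rw [← Category.assoc, ← hs]; simp) (by simp)
    obtain ⟨h⟩ := H f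
    have e₀ := hσ.homotopy_zero_f_zero h
    rw [h₀] at e₀
    have : b' = h.hom 0 (-1) ≫ M.toCycles (-1) 0 := by
      rw [← cancel_mono (M.iCycles 0), e₀]
      simp
    simp [← hb', this]
  · let b := M.liftCycles (f.f 0) 1 (by simp) (by
      rw [f.comm, (hσ.2 1 (by decide) (by decide)).eq_of_tgt (σ.d 0 1) 0, zero_comp])
    have hb : σ.d (-1) 0 ≫ b = f.f (-1) ≫ M.toCycles (-1) 0 := by
      rw [← cancel_mono (M.iCycles 0)]
      simp [b]
    obtain ⟨t, ht⟩ := exists_toCycles_of_comp_homologyπ_eq_zero (i := -1) (by simp) b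
      (hI _ (by rw [reassoc_of% hb]; simp))
    have ht' : t ≫ M.d (-1) 0 = f.f 0 := by
      rw [← M.toCycles_i, reassoc_of% ht]
      simp [b]
    let a := M.liftCycles (f.f (-1) - σ.d (-1) 0 ≫ t) 0 (by simp) (by simp [ht'])
    obtain ⟨k, hk⟩ := hD (a ≫ M.homologyπ (-1))
    let k' := Projective.factorThru k (M.homologyπ (-1))
    have hk' : k' ≫ M.homologyπ (-1) = k := Projective.factorThru_comp _ _
    obtain ⟨s, hs⟩ := exists_toCycles_of_comp_homologyπ_eq_zero (i := -2) (by simp)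
      (a - σ.d (-1) 0 ≫ k') (by
        rw [Preadditive.sub_comp, Category.assoc, hk', ← hk, sub_self])
    refine hσ.nonempty_homotopy_zero f s (t + k' ≫ M.iCycles (-1)) ?_ (by simp [ht'])
    rw [← M.toCycles_i, reassoc_of% hs]
    simp [a]

end

section

variable {σ : CochainComplex (ModuleCat.{u} R) ℤ}

open DerivedCategory

lemma mem_Dclass_of_iso {X Y : ModuleCat.{u} R} (e : X ≅ Y) (hX : X ∈ Dclass σ) :
    Y ∈ Dclass σ := fun a => by
  obtain ⟨φ, hφ⟩ := hX (a ≫ e.inv)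
  exact ⟨φ ≫ e.hom, by simpa using hφ =≫ e.hom⟩

lemma mem_InjClass_of_iso {X Y : ModuleCat.{u} R} (e : X ≅ Y) (hX : X ∈ InjClass σ) :
    Y ∈ InjClass σ := fun φ hφ => by
  rw [← cancel_mono e.inv, zero_comp]
  exact hX _ (by rw [reassoc_of% hφ, zero_comp])

lemma mem_Dclass_of_isZero {X : ModuleCat.{u} R} (hX : IsZero X) : X ∈ Dclass σ :=
  fun _ => ⟨0, hX.eq_of_tgt _ _⟩

lemma mem_InjClass_of_isZero {X : ModuleCat.{u} R} (hX : IsZero X) : X ∈ InjClass σ :=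
  fun _ _ => hX.eq_of_tgt _ _

lemma TwoTermProj.isKProjective (hσ : TwoTermProj σ) : σ.IsKProjective := by
  have := hσ.1
  have : σ.IsStrictlyLE 0 := by
    rw [CochainComplex.isStrictlyLE_iff]
    exact fun i hi => hσ.2 i (by lia) (by lia)
  exact CochainComplex.isKProjective_of_projective σ 0

lemma forall_Q_obj_hom_eq_zero_iff [σ.IsKProjective] (M : CochainComplex (ModuleCat.{u} R) ℤ) :
    (∀ f : Q.obj σ ⟶ Q.obj M, f = 0) ↔ ∀ f : σ ⟶ M, Nonempty (Homotopy f 0) := by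
  have hQ := CochainComplex.IsKProjective.Qh_map_bijective σ
    ((HomotopyCategory.quotient _ _).obj M)
  refine ⟨fun H f => ?_, fun H f => ?_⟩
  · rw [← HomotopyCategory.quotient_map_eq_zero_iff]
    apply hQ.injective
    have := (quotientCompQhIso (ModuleCat.{u} R)).hom.naturality f
    rw [H (Q.map f), comp_zero, ← IsIso.eq_comp_inv, zero_comp] at this
    exact this.trans (Functor.map_zero _ _ _).symm
  · obtain ⟨g, hg⟩ := hQ.surjective
      ((quotientCompQhIso _).hom.app σ ≫ f ≫ (quotientCompQhIso _).inv.app M)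
    obtain ⟨g, rfl⟩ := (HomotopyCategory.quotient _ _).map_surjective g
    rw [(HomotopyCategory.quotient_map_eq_zero_iff g).2 (H g), Functor.map_zero] at hg
    simpa using hg.symm

lemma TwoTermProj.forall_hom_eq_zero_iff (hσ : TwoTermProj σ)
    (Z : DerivedCategory (ModuleCat.{u} R)) :
    (∀ f : Q.obj σ ⟶ Z, f = 0) ↔
      (homologyFunctor _ (-1)).obj Z ∈ Dclass σ ∧ (homologyFunctor _ 0).obj Z ∈ InjClass σ := by
  have := hσ.isKProjective
  let M := Q.objPreimage Z
  let e : Q.obj M ≅ Z := Q.objObjPreimageIso Z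
  let e' (n : ℤ) : M.homology n ≅ (homologyFunctor _ n).obj Z :=
    (homologyFunctorFactors _ n).symm.app M ≪≫ (homologyFunctor _ n).mapIso e
  have h₁ : (∀ f : Q.obj σ ⟶ Z, f = 0) ↔ ∀ f : Q.obj σ ⟶ Q.obj M, f = 0 :=
    ⟨fun H f => by rw [← cancel_mono e.hom, zero_comp]; exact H _,
      fun H f => by rw [← cancel_mono e.inv, zero_comp]; exact H _⟩
  rw [h₁, forall_Q_obj_hom_eq_zero_iff, hσ.forall_nonempty_homotopy_zero_iff]
  exact ⟨fun h => ⟨mem_Dclass_of_iso (e' _) h.1, mem_InjClass_of_iso (e' _) h.2⟩,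
    fun h => ⟨mem_Dclass_of_iso (e' _).symm h.1, mem_InjClass_of_iso (e' _).symm h.2⟩⟩

/-- Vanishing of morphisms from a 2-term complex of projectives into shifts, in terms of
cohomology. -/
lemma TwoTermProj.forall_hom_shift_eq_zero_iff (hσ : TwoTermProj σ)
    (Z : DerivedCategory (ModuleCat.{u} R)) :
    (∀ i : ℤ, 0 < i → ∀ f : Q.obj σ ⟶ Z⟦i⟧, f = 0) ↔
      (∀ i : ℤ, 0 ≤ i → (homologyFunctor _ i).obj Z ∈ Dclass σ) ∧
        ∀ i : ℤ, 0 < i → (homologyFunctor _ i).obj Z ∈ InjClass σ := by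
  let e (i a b : ℤ) (h : i + a = b) :
      (homologyFunctor _ a).obj (Z⟦i⟧) ≅ (homologyFunctor _ b).obj Z :=
    ((homologyFunctor (ModuleCat.{u} R) 0).shiftIso i a b h).app Z
  simp only [hσ.forall_hom_eq_zero_iff]
  refine ⟨fun h => ⟨fun i hi => mem_Dclass_of_iso (e (i + 1) (-1) i (by simp))
    (h (i + 1) (by lia)).1, fun i hi => mem_InjClass_of_iso (e i 0 i (by simp)) (h i hi).2⟩,
    fun h i hi => ⟨mem_Dclass_of_iso (e i (-1) (i - 1) (by lia)).symm (h.1 _ (by lia)),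
      mem_InjClass_of_iso (e i 0 i (by simp)).symm (h.2 i hi)⟩⟩

end

/-- A coproduct may be reindexed by dropping zero summands. -/
lemma nonempty_isColimit_cofan_of_injective {C : Type*} [Category* C] [HasZeroMorphisms C]
    {J J' : Type*} {f : J → C} {c : Cofan f} (hc : IsColimit c) {e : J' → J}
    (he : Function.Injective e) (hf : ∀ j, j ∉ Set.range e → IsZero (f j)) :
    Nonempty (IsColimit (Cofan.mk c.pt (fun j => c.inj (e j)))) := by
  have hg (s : Cofan (fun j => f (e j))) (j : J) : ∃ g : f j ⟶ s.pt,
      ∀ j' (h : j = e j'), g = eqToHom (by rw [h]) ≫ s.inj j' := by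
    by_cases hj : j ∈ Set.range e
    · obtain ⟨i, rfl⟩ := hj
      refine ⟨s.inj i, fun j' h => ?_⟩
      obtain rfl := he h
      simp
    · exact ⟨0, fun j' h => (hj ⟨j', h.symm⟩).elim⟩
  choose g hg using hg
  refine ⟨Cofan.IsColimit.mk _ (fun s => Cofan.IsColimit.desc hc (g s)) (fun s j => ?_)
    (fun s m hm => Cofan.IsColimit.hom_ext hc _ _ (fun j => ?_))⟩
  · simp [hg s (e j) j rfl]
  · by_cases hj : j ∈ Set.range e
    · obtain ⟨i, rfl⟩ := hj
      rw [Cofan.IsColimit.fac hc (g s) (e i), hg s (e i) i rfl]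
      simpa using hm i
    · exact (hf j hj).eq_of_src _ _

section

open DerivedCategory

lemma isZero_of_isZero_homologyFunctor_obj {Z : DerivedCategory (ModuleCat.{u} R)}
    (hZ : ∀ n, IsZero ((homologyFunctor _ n).obj Z)) : IsZero Z := by
  have : IsIso (0 : Z ⟶ Z) := by
    rw [isIso_iff]
    exact fun n => ⟨0, (hZ n).eq_of_src _ _, (hZ n).eq_of_src _ _⟩
  rw [IsZero.iff_id_eq_zero, ← cancel_epi (0 : Z ⟶ Z), zero_comp, zero_comp]

/-- A coproduct in the derived category only has a small set of nonzero summands. -/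
lemma small_nonzero_summands {J : Type*} {Z : J → DerivedCategory (ModuleCat.{u} R)}
    {c : Cofan Z} (hc : IsColimit c) : Small.{u} {j // ¬ IsZero (Z j)} := by
  obtain ⟨p, hp⟩ := exists_orthogonalRetractions hc
  have hx (j : {j // ¬ IsZero (Z j)}) :
      ∃ (n : ℤ) (x : (homologyFunctor (ModuleCat.{u} R) n).obj (Z j)), x ≠ 0 := by
    by_contra! h
    exact j.2 (isZero_of_isZero_homologyFunctor_obj (fun n =>
      @ModuleCat.isZero_of_subsingleton _ _ _ (subsingleton_of_forall_eq 0 (h n))))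
  choose n x hx using hx
  let F (j : {j // ¬ IsZero (Z j)}) : Σ n : ℤ, (homologyFunctor (ModuleCat.{u} R) n).obj c.pt :=
    ⟨n j, ((homologyFunctor _ (n j)).map (c.inj j)).hom (x j)⟩
  refine small_of_injective (f := F) (fun i j hij => ?_)
  by_contra hne
  refine hx i ?_
  have h₁ : ((homologyFunctor _ (n i)).map (p i)).hom
      (((homologyFunctor _ (n i)).map (c.inj i)).hom (x i)) = x i := by
    have := (hp.map (homologyFunctor _ (n i))).comp_self i
    exact congrArg (fun k => k.hom (x i)) this
  have h₂ : ((homologyFunctor _ (n j)).map (p i)).hom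
      (((homologyFunctor _ (n j)).map (c.inj j)).hom (x j)) = 0 := by
    have := (hp.map (homologyFunctor _ (n j))).comp_of_ne j i
      (fun h => hne (Subtype.ext h.symm))
    exact congrArg (fun k => k.hom (x j)) this
  rw [← h₁]
  exact (congrArg (fun y : Σ n : ℤ, (homologyFunctor (ModuleCat.{u} R) n).obj c.pt =>
    ((homologyFunctor _ y.1).map (p i)).hom y.2 = 0) hij).mpr h₂

lemma exists_small_isColimit {J : Type*} {Z : J → DerivedCategory (ModuleCat.{u} R)}
    {c : Cofan Z} (hc : IsColimit c) :
    ∃ (J' : Type u) (e : J' → J), Nonempty (IsColimit (Cofan.mk c.pt (fun j => c.inj (e j)))) := by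
  have := small_nonzero_summands hc
  refine ⟨Shrink.{u} {j // ¬ IsZero (Z j)}, fun j => ((equivShrink _).symm j).1,
    nonempty_isColimit_cofan_of_injective hc
      (Subtype.val_injective.comp (equivShrink _).symm.injective) (fun j hj => ?_)⟩
  by_contra h
  exact hj ⟨equivShrink _ ⟨j, h⟩, by simp⟩

variable {σ : CochainComplex (ModuleCat.{u} R) ℤ}

lemma mem_InjClass_of_isColimit {J : Type*} {f : J → ModuleCat.{u} R} {c : Cofan f}
    (hc : IsColimit c) (hf : ∀ j, f j ∈ InjClass σ) : c.pt ∈ InjClass σ := fun φ hφ => by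
  obtain ⟨p, hp⟩ := exists_orthogonalRetractions hc
  exact hp.eq_zero (JointlyEpi.of_isColimit hc) φ
    (fun j => hf j _ (by rw [reassoc_of% hφ, zero_comp]))

/-- For a complex vanishing in positive degrees, being right orthogonal to the negative shifts of
`σ` only depends on the cohomology in degree zero. -/
lemma TwoTermProj.forall_hom_shift_Q_eq_zero_iff (hσ : TwoTermProj σ)
    {K : CochainComplex (ModuleCat.{u} R) ℤ} (hK : ∀ i, 0 < i → IsZero (K.X i)) :
    (∀ i : ℤ, 0 < i → ∀ f : Q.obj σ ⟶ (Q.obj K)⟦i⟧, f = 0) ↔ K.homology 0 ∈ Dclass σ := by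
  let e (n : ℤ) : (homologyFunctor _ n).obj (Q.obj K) ≅ K.homology n :=
    (homologyFunctorFactors _ n).app K
  have hz (i : ℤ) (hi : 0 < i) : IsZero ((homologyFunctor _ i).obj (Q.obj K)) :=
    (HomologicalComplex.ExactAt.of_isZero (hK i hi)).isZero_homology.of_iso (e i)
  rw [hσ.forall_hom_shift_eq_zero_iff]
  refine ⟨fun h => mem_Dclass_of_iso (e 0) (h.1 0 le_rfl), fun h => ⟨fun i hi => ?_,
    fun i hi => mem_InjClass_of_isZero (hz i hi)⟩⟩
  obtain rfl | hi := hi.eq_or_lt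
  · exact mem_Dclass_of_iso (e 0).symm h
  · exact mem_Dclass_of_isZero (hz i hi)

lemma TwoTermProj.closedUnderCoproducts_of_Dclass (hσ : TwoTermProj σ)
    (h : ClosedUnderCoproducts (Dclass σ)) :
    ClosedUnderCoproducts {Z : DerivedCategory (ModuleCat.{u} R) |
      ∀ i : ℤ, 0 < i → ∀ f : Q.obj σ ⟶ Z⟦i⟧, f = 0} := by
  intro J Z c hc hZ
  obtain ⟨J', e, ⟨hc'⟩⟩ := exists_small_isColimit hc
  have hZ' j := (hσ.forall_hom_shift_eq_zero_iff _).1 (hZ j)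
  refine (hσ.forall_hom_shift_eq_zero_iff _).2 ⟨fun i hi => ?_, fun i hi => ?_⟩
  · obtain ⟨hi'⟩ := nonempty_isColimit_homologyFunctor hc' i
    exact h _ _ _ hi' (fun j => (hZ' _).1 i hi)
  · obtain ⟨hi'⟩ := nonempty_isColimit_homologyFunctor hc' i
    exact mem_InjClass_of_isColimit hi' (fun j => (hZ' _).2 i hi)

lemma TwoTermProj.closedUnderCoproducts_Dclass (hσ : TwoTermProj σ)
    (h : ClosedUnderCoproducts {Z : DerivedCategory (ModuleCat.{u} R) |
      ∀ i : ℤ, 0 < i → ∀ f : Q.obj σ ⟶ Z⟦i⟧, f = 0}) :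
    ClosedUnderCoproducts (Dclass σ) := by
  intro J f c hc hf
  let S := HomologicalComplex.single (ModuleCat.{u} R) (ComplexShape.up ℤ) 0
  have hS (X : ModuleCat.{u} R) :
      (∀ i : ℤ, 0 < i → ∀ g : Q.obj σ ⟶ (Q.obj (S.obj X))⟦i⟧, g = 0) ↔ X ∈ Dclass σ := by
    rw [hσ.forall_hom_shift_Q_eq_zero_iff
      (fun i hi => HomologicalComplex.isZero_single_obj_X _ _ _ _ hi.ne')]
    let e := HomologicalComplex.singleObjHomologySelfIso (ComplexShape.up ℤ) (0 : ℤ) X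
    exact ⟨mem_Dclass_of_iso e, mem_Dclass_of_iso e.symm⟩
  have hc' := isColimitCofanMkObjOfIsColimit S _ c.inj (hc.ofIsoColimit (Cofan.ext (Iso.refl _)))
  obtain ⟨hQ⟩ := nonempty_isColimit_Q hc'
  obtain ⟨hQ'⟩ := nonempty_isColimit_cofan_of_injective hQ (e := ULift.down.{u + 1})
    ULift.down_injective (fun j hj => (hj ⟨⟨j⟩, rfl⟩).elim)
  exact (hS c.pt).1 (h _ _ _ hQ' (fun j => (hS _).2 (hf j.down)))

end

/-- **Proposition 1.25(2)**: an `R`-module `T` is a partial silting module if and only if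
there exists a 2-term partial silting complex `σ` with `H^0(σ) = T`. -/
theorem isPartialSiltingModule_iff
    (T : ModuleCat.{u} R) :
    (∃ σ : CochainComplex (ModuleCat.{u} R) ℤ, TwoTermProj σ ∧
        Nonempty (σ.homology 0 ≅ T) ∧ T ∈ Dclass σ ∧ ClosedUnderCoproducts (Dclass σ))
    ↔ (∃ σ : CochainComplex (ModuleCat.{u} R) ℤ, TwoTermProj σ ∧
        Nonempty (σ.homology 0 ≅ T) ∧ IsPartialSiltingComplex σ) := by
  refine exists_congr fun σ => and_congr_right fun hσ => and_congr_right fun ⟨e⟩ => ?_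
  refine and_congr ?_ ⟨hσ.closedUnderCoproducts_of_Dclass, hσ.closedUnderCoproducts_Dclass⟩
  rw [hσ.forall_hom_shift_Q_eq_zero_iff (fun i hi => hσ.2 i (by lia) hi.ne')]
  exact ⟨mem_Dclass_of_iso e.symm, mem_Dclass_of_iso e⟩

end

end Glue
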